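/- The linear map from the direct sum over k ≥ 1 of the k-fold tensor powers (over ℚ) of Prim to WQSym_+, sending p_1 ⊗ p_2 ⊗ ⋯ ⊗ p_k to p_1 ≺ (p_2 ≺ (⋯ ≺ p_k)⋯) (and p_1 to p_1 when k = 1), is a linear isomorphism. -/

import Mathlib

open scoped TensorProduct Classical DirectSum

/-- The maximum letter of a word, with `wmax [] = 0`. -/
def wmax (w : List ℕ) : ℕ := w.foldr max 0

/-- A word over the positive integers is packed if every letter from `1` to its maximum
occurs in it. -/
def IsPacked (w : List ℕ) : Prop :=
  (∀ x ∈ w, 0 < x) ∧ ∀ i : ℕ, 0 < i → i ≤ wmax w → i ∈ w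

/-- `pack w` replaces every occurrence of the `i`-th smallest distinct letter of `w` by `i`. -/
def pack (w : List ℕ) : List ℕ :=
  w.map (fun a => (w.dedup.filter (fun b => b < a)).length + 1)

/-- The ambient free `ℚ`-vector space on all words. -/
abbrev V : Type := List ℕ →₀ ℚ

noncomputable instance : Zero (V ⊗[ℚ] V) :=
  (inferInstance : AddZeroClass (V ⊗[ℚ] V)).toZero

/-- The basis element `R_w`. -/
noncomputable def Rw (w : List ℕ) : V := Finsupp.single w 1

/-- `WQSym₊`: the span of the `R_w` over nonempty packed words `w`. -/
noncomputable def Wplus : Submodule ℚ V :=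
  Submodule.span ℚ {x : V | ∃ w : List ℕ, IsPacked w ∧ w ≠ [] ∧ x = Rw w}

/-- A valid cut for `Δ_≺` at position `i`: `1 ≤ i ≤ |w| - 1`, the letter sets of the two
factors are disjoint, and all occurrences of the maximum letter lie in the first `i`
positions. -/
def okL (w : List ℕ) (i : ℕ) : Prop :=
  1 ≤ i ∧ i < w.length ∧ (∀ a ∈ w.take i, a ∉ w.drop i) ∧ wmax w ∉ w.drop i

/-- A valid cut for `Δ_≻` at position `i`: `1 ≤ i ≤ |w| - 1`, the letter sets of the two
factors are disjoint, and all occurrences of the maximum letter lie in the last `n - i`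
positions. -/
def okR (w : List ℕ) (i : ℕ) : Prop :=
  1 ≤ i ∧ i < w.length ∧ (∀ a ∈ w.take i, a ∉ w.drop i) ∧ wmax w ∉ w.take i

noncomputable def cutsL (w : List ℕ) : V ⊗[ℚ] V :=
  ((((List.range w.length).filter (fun i => decide (okL w i))).map
    (fun i => Rw (pack (w.take i)) ⊗ₜ[ℚ] Rw (pack (w.drop i)))) : List (V ⊗[ℚ] V)).sum

noncomputable def cutsR (w : List ℕ) : V ⊗[ℚ] V :=
  ((((List.range w.length).filter (fun i => decide (okR w i))).map
    (fun i => Rw (pack (w.take i)) ⊗ₜ[ℚ] Rw (pack (w.drop i)))) : List (V ⊗[ℚ] V)).sum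

/-- The left half-coproduct `Δ_≺` of `WQSym₊`. -/
noncomputable def deltaL : V →ₗ[ℚ] V ⊗[ℚ] V :=
  Finsupp.lsum ℚ fun w => LinearMap.toSpanSingleton ℚ (V ⊗[ℚ] V) (cutsL w)

/-- The right half-coproduct `Δ_≻` of `WQSym₊`. -/
noncomputable def deltaR : V →ₗ[ℚ] V ⊗[ℚ] V :=
  Finsupp.lsum ℚ fun w => LinearMap.toSpanSingleton ℚ (V ⊗[ℚ] V) (cutsR w)

/-- Shift every letter of `w` by `m`. -/
def shiftW (m : ℕ) (w : List ℕ) : List ℕ := w.map (· + m)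

/-- The list of all shuffles of two words (with multiplicity). -/
def shuf : List ℕ → List ℕ → List (List ℕ)
  | [], v => [v]
  | u, [] => [u]
  | a :: u, b :: v => (shuf u (b :: v)).map (a :: ·) ++ (shuf (a :: u) v).map (b :: ·)
termination_by u v => u.length + v.length

/-- The left half-shuffle `ua ≺ vb := (u ⧢ vb)·a` (as a list of words). -/
def halfShL (u v : List ℕ) : List (List ℕ) :=
  (shuf u.dropLast v).map (fun w => w ++ [u.getLastD 0])

/-- The formal sum of a list of words in `V`. -/
noncomputable def rsum (l : List (List ℕ)) : V := (l.map Rw).sum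

/-- The half-product `≺` on `WQSym₊`: `R_u ≺ R_v = Σ_{w ∈ u ≺ v[u]} R_w`. -/
noncomputable def mulL : V →ₗ[ℚ] V →ₗ[ℚ] V :=
  Finsupp.lsum ℚ fun u => LinearMap.toSpanSingleton ℚ (V →ₗ[ℚ] V)
    (Finsupp.lsum ℚ fun v =>
      LinearMap.toSpanSingleton ℚ V (rsum (halfShL u (shiftW (wmax u) v))))

/-- The primitive elements of `WQSym₊`: `Prim = Ker (Δ_≺ + Δ_≻)`. -/
noncomputable def Prim : Submodule ℚ V :=
  Wplus ⊓ LinearMap.ker (deltaL + deltaR)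

/-- The iterated left half-product `p₁ ≺ (p₂ ≺ (⋯ ≺ p_k)⋯)`. -/
noncomputable def nest : List V → V
  | [] => 0
  | [x] => x
  | x :: y :: t => mulL x (nest (y :: t))


/-! ### Combinatorics of words -/

namespace WQ

theorem le_wmax {w : List ℕ} {x : ℕ} (h : x ∈ w) : x ≤ wmax w := by
  induction w with
  | nil => simp at h
  | cons a w ih =>
    simp only [wmax, List.foldr_cons] at *
    rcases List.mem_cons.1 h with rfl | h
    · exact le_max_left _ _
    · exact (ih h).trans (le_max_right _ _)

theorem wmax_mem {w : List ℕ} (h : w ≠ []) : wmax w ∈ w := by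
  induction w with
  | nil => simp at h
  | cons a w ih =>
    by_cases hw : w = []
    · subst hw; simp [wmax]
    · have := ih hw
      have e : wmax (a :: w) = max a (wmax w) := rfl
      rw [e]
      rcases max_choice a (wmax w) with h1 | h1 <;> rw [h1]
      · simp
      · exact List.mem_cons_of_mem _ this

theorem wmax_eq_of {w : List ℕ} {n : ℕ} (h : ∀ x, x ∈ w ↔ 1 ≤ x ∧ x ≤ n) : wmax w = n := by
  by_cases hw : w = []
  · subst hw
    have := h n
    simp at this
    simp [wmax]
    omega
  · have h1 := (h _).1 (wmax_mem hw)
    have h2 := le_wmax ((h n).2 ⟨by omega, le_rfl⟩)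
    omega

theorem packed_of {w : List ℕ} {n : ℕ} (h : ∀ x, x ∈ w ↔ 1 ≤ x ∧ x ≤ n) : IsPacked w := by
  refine ⟨fun x hx => ((h x).1 hx).1, fun i hi hi2 => ?_⟩
  rw [wmax_eq_of h] at hi2
  exact (h i).2 ⟨hi, hi2⟩

theorem packed_mem {w : List ℕ} (h : IsPacked w) (x : ℕ) : x ∈ w ↔ 1 ≤ x ∧ x ≤ wmax w :=
  ⟨fun hx => ⟨h.1 x hx, le_wmax hx⟩, fun hx => h.2 x hx.1 hx.2⟩

def rank (w : List ℕ) (a : ℕ) : ℕ := (w.dedup.filter (fun b => b < a)).length + 1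

theorem pack_eq (w : List ℕ) : pack w = w.map (rank w) := rfl

theorem rank_eq (w : List ℕ) (a : ℕ) : rank w a = (w.toFinset.filter (· < a)).card + 1 := by
  rfl

theorem rank_lt {w : List ℕ} {a b : ℕ} (ha : a ∈ w) (hab : a < b) : rank w a < rank w b := by
  rw [rank_eq, rank_eq]
  have : (w.toFinset.filter (· < a)).card < (w.toFinset.filter (· < b)).card := by
    apply Finset.card_lt_card
    rw [Finset.ssubset_iff_of_subset]
    · exact ⟨a, by simp [ha, hab], by simp⟩
    · intro x hx; simp at hx ⊢; exact ⟨hx.1, by omega⟩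
  omega

theorem rank_le {w : List ℕ} {a : ℕ} (ha : a ∈ w) : rank w a ≤ w.toFinset.card := by
  rw [rank_eq]
  have : (w.toFinset.filter (· < a)).card < w.toFinset.card := by
    apply Finset.card_lt_card
    rw [Finset.ssubset_iff_of_subset]
    · exact ⟨a, by simp [ha], by simp⟩
    · exact Finset.filter_subset _ _
  omega

theorem rank_inj {w : List ℕ} {a b : ℕ} (ha : a ∈ w) (hb : b ∈ w) (h : rank w a = rank w b) :
    a = b := by
  rcases lt_trichotomy a b with h1 | h1 | h1
  · have := rank_lt ha h1; omega
  · exact h1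
  · have := rank_lt hb h1; omega

theorem pack_mem (w : List ℕ) (x : ℕ) : x ∈ pack w ↔ 1 ≤ x ∧ x ≤ w.toFinset.card := by
  have h : w.toFinset.image (rank w) = Finset.Icc 1 w.toFinset.card := by
    apply Finset.eq_of_subset_of_card_le
    · intro x hx
      simp only [Finset.mem_image, List.mem_toFinset] at hx
      obtain ⟨a, ha, rfl⟩ := hx
      simp only [Finset.mem_Icc]
      exact ⟨by unfold rank; omega, rank_le ha⟩
    · rw [Finset.card_image_of_injOn]
      · simp
      · intro a ha b hb hab
        simp at ha hb
        exact rank_inj ha hb hab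
  have := Finset.ext_iff.1 h x
  simpa [pack_eq] using this

theorem pack_packed (w : List ℕ) : IsPacked (pack w) := packed_of (pack_mem w)

theorem pack_map {w : List ℕ} {f : ℕ → ℕ} (hf : ∀ a ∈ w, ∀ b ∈ w, a < b → f a < f b) :
    pack (w.map f) = pack w := by
  rw [pack_eq, pack_eq, List.map_map]
  apply List.map_congr_left
  intro a ha
  simp only [Function.comp, rank_eq]
  congr 1
  have : (w.map f).toFinset.filter (· < f a) = (w.toFinset.filter (· < a)).image f := by
    ext x
    simp only [Finset.mem_filter, List.mem_toFinset, List.mem_map, Finset.mem_image]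
    constructor
    · rintro ⟨⟨b, hb, rfl⟩, h⟩
      refine ⟨b, ⟨hb, ?_⟩, rfl⟩
      by_contra h2
      rcases Nat.lt_or_ge a b with h3 | h3
      · have := hf a ha b hb h3; omega
      · have : a = b := by omega
        subst this; omega
    · rintro ⟨b, ⟨hb, hba⟩, rfl⟩
      exact ⟨⟨b, hb, rfl⟩, hf b hb a ha hba⟩
  rw [this, Finset.card_image_of_injOn]
  intro x hx y hy hxy
  simp at hx hy
  rcases lt_trichotomy x y with h1 | h1 | h1
  · have := hf x hx.1 y hy.1 h1; omega
  · exact h1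
  · have := hf y hy.1 x hx.1 h1; omega

theorem pack_self {w : List ℕ} (h : IsPacked w) : pack w = w := by
  rw [pack_eq]
  conv_rhs => rw [← List.map_id w]
  apply List.map_congr_left
  intro a ha
  have h1 := (packed_mem h a).1 ha
  have : w.toFinset.filter (· < a) = Finset.Ico 1 a := by
    ext x
    simp only [Finset.mem_filter, List.mem_toFinset, packed_mem h, Finset.mem_Ico]
    omega
  rw [rank_eq, this]
  simp; omega

@[simp] theorem pack_nil : pack [] = [] := rfl
@[simp] theorem pack_length (w : List ℕ) : (pack w).length = w.length := by simp [pack]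

theorem pack_ne {w : List ℕ} (h : w ≠ []) : pack w ≠ [] := by
  intro h2
  apply h
  have := pack_length w
  rw [h2] at this
  simpa using this.symm

theorem take_pack (w : List ℕ) (i : ℕ) : pack ((pack w).take i) = pack (w.take i) := by
  rw [pack_eq w, ← List.map_take]
  apply pack_map
  intro a ha b _ hab
  exact rank_lt (List.mem_of_mem_take ha) hab

theorem drop_pack (w : List ℕ) (i : ℕ) : pack ((pack w).drop i) = pack (w.drop i) := by
  rw [pack_eq w, ← List.map_drop]
  apply pack_map
  intro a ha b _ hab
  exact rank_lt (List.mem_of_mem_drop ha) hab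

/-- Disjointness of letters. -/
def dj (x y : List ℕ) : Prop := ∀ a ∈ x, a ∉ y

/-- The set of interior valid cuts. -/
noncomputable def C (w : List ℕ) : Finset ℕ :=
  (Finset.range w.length).filter (fun i => 1 ≤ i ∧ dj (w.take i) (w.drop i))

theorem mem_C {w : List ℕ} {i : ℕ} :
    i ∈ C w ↔ 1 ≤ i ∧ i < w.length ∧ dj (w.take i) (w.drop i) := by
  simp [C]; tauto

theorem dj_pack (w : List ℕ) (i : ℕ) :
    dj ((pack w).take i) ((pack w).drop i) ↔ dj (w.take i) (w.drop i) := by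
  rw [pack_eq, ← List.map_take, ← List.map_drop]
  constructor
  · intro h a ha hb
    exact h _ (List.mem_map_of_mem ha) (List.mem_map_of_mem hb)
  · intro h a ha hb
    obtain ⟨x, hx, rfl⟩ := List.mem_map.1 ha
    obtain ⟨y, hy, hxy⟩ := List.mem_map.1 hb
    have := rank_inj (List.mem_of_mem_drop hy) (List.mem_of_mem_take hx) hxy
    subst this
    exact h _ hx hy

theorem C_pack (w : List ℕ) : C (pack w) = C w := by
  ext i
  simp [mem_C, dj_pack]

theorem take_ne {w : List ℕ} {i : ℕ} (hi : i ∈ C w) : w.take i ≠ [] := by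
  have := mem_C.1 hi
  intro h
  have := congrArg List.length h
  rw [List.length_take, List.length_nil] at this; omega

theorem drop_ne {w : List ℕ} {i : ℕ} (hi : i ∈ C w) : w.drop i ≠ [] := by
  have := mem_C.1 hi
  intro h
  have := congrArg List.length h
  simp at this; omega

theorem coassoc {M : Type*} [AddCommMonoid M] (G : List ℕ → List ℕ → List ℕ → M) (w : List ℕ) :
    ∑ i ∈ C w, ∑ j ∈ C (pack (w.take i)),
      G (pack ((pack (w.take i)).take j)) (pack ((pack (w.take i)).drop j)) (pack (w.drop i)) =
    ∑ j ∈ C w, ∑ i ∈ C (pack (w.drop j)),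
      G (pack (w.take j)) (pack ((pack (w.drop j)).take i)) (pack ((pack (w.drop j)).drop i)) := by
  simp only [C_pack, take_pack, drop_pack]
  rw [Finset.sum_sigma', Finset.sum_sigma']
  refine Finset.sum_bij' (fun p _ => ⟨p.2, p.1 - p.2⟩) (fun p _ => ⟨p.1 + p.2, p.1⟩) ?_ ?_ ?_ ?_ ?_
  · rintro ⟨i, j⟩ h
    simp only [Finset.mem_sigma, mem_C, List.length_take, List.length_drop] at h ⊢
    obtain ⟨⟨h1, h2, h3⟩, h4, h5, h6⟩ := h
    have hji : j < i := by omega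
    rw [List.take_take, min_eq_left hji.le] at h6
    have key : w.drop j = (w.take i).drop j ++ w.drop i := by
      conv_lhs => rw [← List.take_append_drop i w]
      rw [List.drop_append_of_le_length (by simp; omega)]
    refine ⟨⟨h4, by omega, ?_⟩, by omega, by omega, ?_⟩
    · intro a ha hb
      rw [key, List.mem_append] at hb
      rcases hb with hb | hb
      · exact h6 a ha hb
      · exact h3 a (by
          have := List.take_subset_take_left w hji.le
          exact this ha) hb
    · intro a ha hb
      rw [List.drop_drop, show j + (i - j) = i by omega] at hb
      rw [← List.drop_take] at ha
      exact h3 a (List.mem_of_mem_drop ha) hb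
  · rintro ⟨j, i⟩ h
    simp only [Finset.mem_sigma, mem_C, List.length_take, List.length_drop] at h ⊢
    obtain ⟨⟨h1, h2, h3⟩, h4, h5, h6⟩ := h
    refine ⟨⟨by omega, by omega, ?_⟩, by omega, by omega, ?_⟩
    · intro a ha hb
      rw [List.take_add, List.mem_append] at ha
      rw [← List.drop_drop] at hb
      rcases ha with ha | ha
      · exact h3 a ha (List.mem_of_mem_drop hb)
      · exact h6 a ha hb
    · intro a ha hb
      rw [List.take_take, min_eq_left (by omega)] at ha
      rw [List.drop_take, show j + i - j = i by omega] at hb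
      exact h3 a ha (List.mem_of_mem_take hb)
  · rintro ⟨i, j⟩ h
    simp only [Finset.mem_sigma, mem_C, List.length_take] at h
    simp; omega
  · rintro ⟨j, i⟩ h
    simp
  · rintro ⟨i, j⟩ h
    simp only [Finset.mem_sigma, mem_C, List.length_take] at h
    simp only [List.take_take, List.drop_drop]
    rw [min_eq_left (by omega), List.drop_take, show j + (i - j) = i by omega]

/-! ### Shuffles -/

section sh
variable {M : Type*} [AddCommMonoid M]

def sh (u v : List ℕ) (f : List ℕ → M) : M := ((shuf u v).map f).sum

theorem shuf_nil_left (v : List ℕ) : shuf [] v = [v] := by rw [shuf]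
theorem shuf_nil_right (u : List ℕ) : shuf u [] = [u] := by
  cases u <;> simp [shuf]

theorem sh_nil_left (v : List ℕ) (f : List ℕ → M) : sh [] v f = f v := by
  simp [sh, shuf_nil_left]
theorem sh_nil_right (v : List ℕ) (f : List ℕ → M) : sh v [] f = f v := by
  simp [sh, shuf_nil_right]
theorem sh_cons (a b : ℕ) (u v : List ℕ) (f : List ℕ → M) :
    sh (a :: u) (b :: v) f =
      sh u (b :: v) (fun x => f (a :: x)) + sh (a :: u) v (fun x => f (b :: x)) := by
  simp [sh, shuf, Function.comp_def]

theorem sh_add (u v : List ℕ) (f g : List ℕ → M) :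
    sh u v (fun x => f x + g x) = sh u v f + sh u v g := by
  simp [sh, List.sum_map_add]

theorem sh_zero (u v : List ℕ) : sh u v (fun _ => (0 : M)) = 0 := by
  simp [sh]

theorem sh_congr {u v : List ℕ} {f g : List ℕ → M} (h : ∀ w ∈ shuf u v, f w = g w) :
    sh u v f = sh u v g := by
  unfold sh; congr 1; exact List.map_congr_left h

def sp (w : List ℕ) (F : List ℕ → List ℕ → M) : M :=
  ∑ i ∈ Finset.range (w.length + 1), F (w.take i) (w.drop i)

theorem sp_nil (F : List ℕ → List ℕ → M) : sp [] F = F [] [] := by simp [sp]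
theorem sp_cons (a : ℕ) (w : List ℕ) (F : List ℕ → List ℕ → M) :
    sp (a :: w) F = F [] (a :: w) + sp w (fun x y => F (a :: x) y) := by
  unfold sp
  rw [List.length_cons, Finset.sum_range_succ', add_comm]
  simp
theorem sp_add (w : List ℕ) (F G : List ℕ → List ℕ → M) :
    sp w (fun x y => F x y + G x y) = sp w F + sp w G := by
  simp [sp, Finset.sum_add_distrib]

theorem sp_sh (u v : List ℕ) (F : List ℕ → List ℕ → M) :
    sh u v (fun w => sp w F) =
      sp u (fun u1 u2 => sp v (fun v1 v2 => sh u1 v1 (fun x => sh u2 v2 (fun y => F x y)))) := by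
  induction u generalizing v F with
  | nil => simp [sh_nil_left, sp_nil]
  | cons a u ihu =>
    induction v generalizing F with
    | nil => simp [sh_nil_right, sp_nil]
    | cons b v ihv =>
      rw [sh_cons]
      simp only [sp_cons a, sp_cons b, sh_add, ihu, ihv]
      simp only [sh_nil_left, sh_nil_right, sh_cons, sp_add, sh_add]
      abel

theorem mem_shuf {u v w : List ℕ} (h : w ∈ shuf u v) (x : ℕ) : x ∈ w ↔ x ∈ u ∨ x ∈ v := by
  induction u generalizing v w with
  | nil => simp [shuf_nil_left] at h; simp [h]
  | cons a u ihu =>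
    induction v generalizing w with
    | nil => simp [shuf_nil_right] at h; simp [h]
    | cons b v ihv =>
      simp only [shuf, List.mem_append, List.mem_map] at h
      rcases h with ⟨w', h, rfl⟩ | ⟨w', h, rfl⟩
      · rw [List.mem_cons, ihu h]; simp; tauto
      · rw [List.mem_cons, ihv h]; simp; tauto

theorem shuf_map (g : ℕ → ℕ) (u v : List ℕ) :
    (shuf u v).map (List.map g) = shuf (u.map g) (v.map g) := by
  induction u generalizing v with
  | nil => simp [shuf_nil_left]
  | cons a u ihu =>
    induction v with
    | nil => simp [shuf_nil_right]
    | cons b v ihv =>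
      have h1 := ihu (b :: v)
      simp only [List.map_cons] at h1 ihv ⊢
      simp only [shuf, List.map_append, List.map_map, ← h1, ← ihv]
      rfl

theorem halfShL_map (g : ℕ → ℕ) {u : List ℕ} (hu : u ≠ []) (v : List ℕ) :
    (halfShL u v).map (List.map g) = halfShL (u.map g) (v.map g) := by
  unfold halfShL
  rw [← List.map_dropLast, ← shuf_map, List.map_map, List.map_map]
  apply List.map_congr_left
  intro w _
  obtain ⟨u', l, rfl⟩ := List.eq_nil_or_concat u |>.resolve_left hu
  simp

theorem mem_halfShL {u v w : List ℕ} (hu : u ≠ []) (h : w ∈ halfShL u v) (x : ℕ) :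
    x ∈ w ↔ x ∈ u ∨ x ∈ v := by
  obtain ⟨u', l, rfl⟩ := List.eq_nil_or_concat u |>.resolve_left hu
  simp only [halfShL, List.mem_map] at h
  obtain ⟨w', h, rfl⟩ := h
  simp only [List.mem_append, mem_shuf h]
  simp; tauto

def hs (u v : List ℕ) (f : List ℕ → M) : M := ((halfShL u v).map f).sum

theorem hs_congr {u v : List ℕ} {f g : List ℕ → M} (h : ∀ w ∈ halfShL u v, f w = g w) :
    hs u v f = hs u v g := by
  unfold hs; congr 1; exact List.map_congr_left h

theorem hs_concat (u v : List ℕ) (l : ℕ) (f : List ℕ → M) :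
    hs (u ++ [l]) v f = sh u v (fun w => f (w ++ [l])) := by
  simp [hs, sh, halfShL, Function.comp_def]

theorem hs_nil {u : List ℕ} (hu : u ≠ []) (f : List ℕ → M) : hs u [] f = f u := by
  obtain ⟨u', l, rfl⟩ := List.eq_nil_or_concat u |>.resolve_left hu
  rw [List.concat_eq_append, hs_concat, sh_nil_right]

/-- Cuts with nonempty right part. -/
def sp' (w : List ℕ) (F : List ℕ → List ℕ → M) : M :=
  ∑ i ∈ Finset.range w.length, F (w.take i) (w.drop i)

theorem sp'_concat (w : List ℕ) (l : ℕ) (F : List ℕ → List ℕ → M) :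
    sp' (w ++ [l]) F = sp w (fun x y => F x (y ++ [l])) := by
  simp only [sp', sp, List.length_append, List.length_singleton]
  apply Finset.sum_congr rfl
  intro i hi
  simp at hi
  rw [List.take_append_of_le_length (by omega), List.drop_append_of_le_length (by omega)]

theorem sp'_hs {u : List ℕ} (hu : u ≠ []) (v : List ℕ) (F : List ℕ → List ℕ → M) :
    hs u v (fun w => sp' w F) =
      sp' u (fun u1 u2 => sp v (fun v1 v2 => sh u1 v1 (fun x => hs u2 v2 (fun y => F x y)))) := by
  obtain ⟨u', l, rfl⟩ := List.eq_nil_or_concat u |>.resolve_left hu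
  simp only [List.concat_eq_append, hs_concat, sp'_concat, sp_sh]

def shiftPack (k : ℕ) (u v : List ℕ) (x : ℕ) : ℕ :=
  if x ≤ k then rank u x else rank v (x - k) + wmax (pack u)

theorem map_shiftPack_left {k : ℕ} {u : List ℕ} (v : List ℕ) (hu : ∀ x ∈ u, x ≤ k) :
    u.map (shiftPack k u v) = pack u := by
  rw [pack_eq]
  apply List.map_congr_left
  intro a ha
  simp [shiftPack, hu a ha]

theorem map_shiftPack_right {k : ℕ} (u : List ℕ) {v : List ℕ} (hv : ∀ x ∈ v, 0 < x) :
    (shiftW k v).map (shiftPack k u v) = shiftW (wmax (pack u)) (pack v) := by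
  rw [pack_eq v, shiftW, shiftW, List.map_map, List.map_map]
  apply List.map_congr_left
  intro a ha
  have := hv a ha
  have h : ¬ (a + k ≤ k) := by omega
  simp only [Function.comp, shiftPack, if_neg h, Nat.add_sub_cancel]

theorem pack_of_mem {k : ℕ} {u v w : List ℕ} (hu : ∀ x ∈ u, x ≤ k) (hv : ∀ x ∈ v, 0 < x)
    (hw : ∀ x, x ∈ w ↔ x ∈ u ∨ x ∈ shiftW k v) : pack w = w.map (shiftPack k u v) := by
  have hmax : wmax (pack u) = u.toFinset.card := wmax_eq_of (pack_mem u)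
  have hP : IsPacked (w.map (shiftPack k u v)) := by
    apply packed_of (n := u.toFinset.card + v.toFinset.card)
    intro x
    have h1 : x ∈ w.map (shiftPack k u v) ↔
        x ∈ u.map (shiftPack k u v) ∨ x ∈ (shiftW k v).map (shiftPack k u v) := by
      simp only [List.mem_map, hw]
      constructor
      · rintro ⟨a, h | h, rfl⟩
        · exact Or.inl ⟨a, h, rfl⟩
        · exact Or.inr ⟨a, h, rfl⟩
      · rintro (⟨a, h, rfl⟩ | ⟨a, h, rfl⟩)
        · exact ⟨a, Or.inl h, rfl⟩
        · exact ⟨a, Or.inr h, rfl⟩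
    rw [h1, map_shiftPack_left v hu, map_shiftPack_right u hv, pack_mem, hmax]
    simp only [shiftW, List.mem_map, pack_mem]
    constructor
    · rintro (h | ⟨a, h, rfl⟩) <;> omega
    · intro h
      by_cases hx : x ≤ u.toFinset.card
      · left; omega
      · right; exact ⟨x - u.toFinset.card, by omega, by omega⟩
  rw [← pack_self hP, pack_map]
  intro a ha b hb hab
  rw [hw] at ha hb
  simp only [shiftW, List.mem_map] at ha hb
  rcases ha with ha | ⟨a, ha, rfl⟩
  · rcases hb with hb | ⟨b, hb, rfl⟩
    · simp only [shiftPack, if_pos (hu a ha), if_pos (hu b hb)]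
      exact rank_lt ha hab
    · have := hv b hb
      have h : ¬ (b + k ≤ k) := by omega
      simp only [shiftPack, if_pos (hu a ha), if_neg h, hmax]
      have := rank_le ha
      have : 0 < rank v (b + k - k) := by unfold rank; omega
      omega
  · have := hv a ha
    rcases hb with hb | ⟨b, hb, rfl⟩
    · have := hu b hb; omega
    · have h : ¬ (b + k ≤ k) := by omega
      have h' : ¬ (a + k ≤ k) := by omega
      simp only [shiftPack, if_neg h, if_neg h', Nat.add_sub_cancel]
      have := rank_lt ha (show a < b by omega)
      omega

theorem sh_pack {k : ℕ} {u v : List ℕ} (hu : ∀ x ∈ u, x ≤ k) (hv : ∀ x ∈ v, 0 < x)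
    (f : List ℕ → M) :
    sh u (shiftW k v) (fun x => f (pack x)) =
      sh (pack u) (shiftW (wmax (pack u)) (pack v)) f := by
  rw [sh_congr (g := fun x => f (x.map (shiftPack k u v)))
    (fun w hw => by rw [pack_of_mem hu hv (mem_shuf hw)])]
  rw [← map_shiftPack_right (k := k) u hv]
  conv_rhs => rw [← map_shiftPack_left v hu]
  unfold sh
  rw [← shuf_map, List.map_map]
  rfl

theorem hs_pack {k : ℕ} {u v : List ℕ} (h0 : u ≠ []) (hu : ∀ x ∈ u, x ≤ k) (hv : ∀ x ∈ v, 0 < x)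
    (f : List ℕ → M) :
    hs u (shiftW k v) (fun x => f (pack x)) =
      hs (pack u) (shiftW (wmax (pack u)) (pack v)) f := by
  rw [hs_congr (g := fun x => f (x.map (shiftPack k u v)))
    (fun w hw => by rw [pack_of_mem hu hv (mem_halfShL h0 hw)])]
  rw [← map_shiftPack_right (k := k) u hv]
  conv_rhs => rw [← map_shiftPack_left v hu]
  unfold hs
  rw [← halfShL_map _ h0, List.map_map]
  rfl

end sh

section compat
variable {M : Type*} [AddCommGroup M]

theorem dj_nil_left (x : List ℕ) : dj [] x := by intro a ha; simp at ha
theorem dj_nil_right (x : List ℕ) : dj x [] := by intro a _; simp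

theorem sp'_dj {w : List ℕ} (hw : w ≠ []) (H : List ℕ → List ℕ → M) :
    sp' w (fun x y => if dj x y then H x y else 0) =
      H [] w + ∑ i ∈ C w, H (w.take i) (w.drop i) := by
  have hl : 0 < w.length := List.length_pos_iff.2 hw
  unfold sp'
  rw [← Finset.sum_filter]
  have : (Finset.range w.length).filter (fun i => dj (w.take i) (w.drop i)) = insert 0 (C w) := by
    ext i
    simp only [Finset.mem_filter, Finset.mem_range, Finset.mem_insert, mem_C]
    constructor
    · rintro ⟨h1, h2⟩
      by_cases hi : i = 0
      · exact Or.inl hi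
      · exact Or.inr ⟨by omega, h1, h2⟩
    · rintro (rfl | h)
      · exact ⟨hl, by simpa using dj_nil_left w⟩
      · exact ⟨h.2.1, h.2.2⟩
  rw [this, Finset.sum_insert (by simp [mem_C])]
  simp

theorem sp_dj {w : List ℕ} (hw : w ≠ []) (H : List ℕ → List ℕ → M) :
    sp w (fun x y => if dj x y then H x y else 0) =
      H [] w + ∑ i ∈ C w, H (w.take i) (w.drop i) + H w [] := by
  rw [← sp'_dj hw]
  unfold sp sp'
  rw [Finset.sum_range_succ]
  simp [dj_nil_right]

theorem sp_shiftW (k : ℕ) (v : List ℕ) (F : List ℕ → List ℕ → M) :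
    sp (shiftW k v) F = sp v (fun x y => F (shiftW k x) (shiftW k y)) := by
  simp [sp, shiftW]

theorem sp_congr {w : List ℕ} {F G : List ℕ → List ℕ → M}
    (h : ∀ i ≤ w.length, F (w.take i) (w.drop i) = G (w.take i) (w.drop i)) : sp w F = sp w G := by
  unfold sp
  apply Finset.sum_congr rfl
  intro i hi
  simp at hi
  exact h i (by omega)

theorem sp'_congr {w : List ℕ} {F G : List ℕ → List ℕ → M}
    (h : ∀ i < w.length, F (w.take i) (w.drop i) = G (w.take i) (w.drop i)) :
    sp' w F = sp' w G := by
  unfold sp'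
  apply Finset.sum_congr rfl
  intro i hi
  simp at hi
  exact h i (by omega)

def K (F : List ℕ → List ℕ → M) (u1 u2 v1 v2 : List ℕ) : M :=
  sh u1 (shiftW (wmax u1) v1) (fun x => hs u2 (shiftW (wmax u2) v2) (fun y => F x y))

noncomputable def Phi (F : List ℕ → List ℕ → M) (v a b : List ℕ) : M :=
  sp v (fun v1 v2 => if dj v1 v2 then K F a b (pack v1) (pack v2) else 0)

theorem hs_add (u v : List ℕ) (f g : List ℕ → M) :
    hs u v (fun x => f x + g x) = hs u v f + hs u v g := by
  simp [hs, List.sum_map_add]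

theorem hs_zero (u v : List ℕ) : hs u v (fun _ => (0 : M)) = 0 := by
  simp [hs]

theorem shiftW_zero (v : List ℕ) : shiftW 0 v = v := by simp [shiftW]

theorem dj_shuffle {k : ℕ} {u1 u2 v1 v2 x y : List ℕ}
    (hu1 : ∀ x ∈ u1, x ≤ k) (hu2 : ∀ x ∈ u2, x ≤ k)
    (hv1 : ∀ x ∈ v1, 0 < x) (hv2 : ∀ x ∈ v2, 0 < x)
    (hx : ∀ a, a ∈ x ↔ a ∈ u1 ∨ a ∈ shiftW k v1)
    (hy : ∀ a, a ∈ y ↔ a ∈ u2 ∨ a ∈ shiftW k v2) :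
    dj x y ↔ dj u1 u2 ∧ dj v1 v2 := by
  unfold dj
  simp only [hx, hy, shiftW, List.mem_map]
  constructor
  · intro h
    refine ⟨fun a ha hb => h a (Or.inl ha) (Or.inl hb), fun a ha hb => ?_⟩
    exact h (a + k) (Or.inr ⟨a, ha, rfl⟩) (Or.inr ⟨a, hb, rfl⟩)
  · rintro ⟨h1, h2⟩ a ha hb
    rcases ha with ha | ⟨a', ha, rfl⟩ <;> rcases hb with hb | ⟨b', hb, hab⟩
    · exact h1 a ha hb
    · have := hu1 _ ha; have := hv2 _ hb; omega
    · have := hu2 _ hb; have := hv1 _ ha; omega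
    · have : b' = a' := by omega
      subst this
      exact h2 _ ha hb

theorem compat_words {u v : List ℕ} (hu : IsPacked u) (hv : IsPacked v) (hu0 : u ≠ [])
    (hv0 : v ≠ []) (F : List ℕ → List ℕ → M) :
    hs u (shiftW (wmax u) v) (fun w => ∑ i ∈ C w, F (pack (w.take i)) (pack (w.drop i))) =
      F v u + ∑ i ∈ C v, hs u (shiftW (wmax u) (pack (v.drop i))) (fun y => F (pack (v.take i)) y)
        + ∑ i ∈ C u, Phi F v (pack (u.take i)) (pack (u.drop i)) := by
  have main := sp'_hs hu0 (shiftW (wmax u) v)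
    (fun x y => if dj x y then F (pack x) (pack y) else 0)
  -- left side
  have hne : ∀ w ∈ halfShL u (shiftW (wmax u) v), w ≠ [] := by
    intro w hw
    simp only [halfShL, List.mem_map] at hw
    obtain ⟨w', _, rfl⟩ := hw
    simp
  rw [hs_congr (g := fun w => F [] (pack w) +
    ∑ i ∈ C w, F (pack (w.take i)) (pack (w.drop i)))
    (fun w hw => by rw [sp'_dj (hne w hw) (fun x y => F (pack x) (pack y))]; rfl)] at main
  rw [hs_add, hs_pack (f := fun y => F [] y) hu0 (fun x hx => le_wmax hx) hv.1,
    pack_self hu, pack_self hv] at main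
  -- right side
  have step : ∀ i < u.length, sp (shiftW (wmax u) v) (fun v1 v2 => sh (u.take i) v1
      (fun x => hs (u.drop i) v2 (fun y => if dj x y then F (pack x) (pack y) else 0))) =
      if dj (u.take i) (u.drop i) then Phi F v (pack (u.take i)) (pack (u.drop i)) else 0 := by
    intro i hi
    have hd : u.drop i ≠ [] := by
      intro h
      have := congrArg List.length h
      rw [List.length_drop, List.length_nil] at this; omega
    have hu1 : ∀ x ∈ u.take i, x ≤ wmax u := fun x hx => le_wmax (List.mem_of_mem_take hx)
    have hu2 : ∀ x ∈ u.drop i, x ≤ wmax u := fun x hx => le_wmax (List.mem_of_mem_drop hx)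
    rw [sp_shiftW]
    have inner : ∀ j ≤ v.length, sh (u.take i) (shiftW (wmax u) (v.take j))
        (fun x => hs (u.drop i) (shiftW (wmax u) (v.drop j))
          (fun y => if dj x y then F (pack x) (pack y) else 0)) =
        if dj (u.take i) (u.drop i) then (if dj (v.take j) (v.drop j) then
          K F (pack (u.take i)) (pack (u.drop i)) (pack (v.take j)) (pack (v.drop j)) else 0)
          else 0 := by
      intro j _
      have hv1 : ∀ x ∈ v.take j, 0 < x := fun x hx => hv.1 _ (List.mem_of_mem_take hx)
      have hv2 : ∀ x ∈ v.drop j, 0 < x := fun x hx => hv.1 _ (List.mem_of_mem_drop hx)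
      have hcong := sh_congr (u := u.take i) (v := shiftW (wmax u) (v.take j))
        (f := fun x => hs (u.drop i) (shiftW (wmax u) (v.drop j))
          (fun y => if dj x y then F (pack x) (pack y) else 0))
        (g := fun x => hs (u.drop i) (shiftW (wmax u) (v.drop j))
          (fun y => if dj (u.take i) (u.drop i) ∧ dj (v.take j) (v.drop j)
            then F (pack x) (pack y) else 0))
        (fun x hx => hs_congr (fun y hy => by
          have := dj_shuffle hu1 hu2 hv1 hv2 (mem_shuf hx) (mem_halfShL hd hy)
          simp only [this]))
      rw [hcong]
      by_cases h1 : dj (u.take i) (u.drop i)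
      · by_cases h2 : dj (v.take j) (v.drop j)
        · simp only [h1, h2, and_self, if_true]
          rw [sh_pack (f := fun x => hs (u.drop i) (shiftW (wmax u) (v.drop j))
            (fun y => F x (pack y))) hu1 hv1]
          unfold K
          exact sh_congr (fun x _ => hs_pack (f := fun y => F x y) hd hu2 hv2)
        · simp only [h1, h2, and_false, if_false, if_true, hs_zero, sh_zero]
      · simp only [h1, false_and, if_false, hs_zero, sh_zero]
    rw [sp_congr (G := fun v1 v2 => if dj (u.take i) (u.drop i) then (if dj v1 v2 then
          K F (pack (u.take i)) (pack (u.drop i)) (pack v1) (pack v2) else 0) else 0) inner]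
    by_cases h1 : dj (u.take i) (u.drop i)
    · simp only [h1, if_true]; rfl
    · simp only [h1, if_false]; simp [sp]
  rw [sp'_congr (G := fun u1 u2 => if dj u1 u2 then Phi F v (pack u1) (pack u2) else 0) step,
    sp'_dj hu0 (fun x y => Phi F v (pack x) (pack y))] at main
  have h0 : Phi F v (pack []) (pack u) = hs u (shiftW (wmax u) v) (fun y => F [] y) +
      ∑ i ∈ C v, hs u (shiftW (wmax u) (pack (v.drop i))) (fun y => F (pack (v.take i)) y) +
      F v u := by
    rw [pack_nil, pack_self hu]
    unfold Phi
    rw [sp_dj hv0 (fun v1 v2 => K F [] u (pack v1) (pack v2))]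
    have hw0 : wmax [] = 0 := rfl
    simp only [K, sh_nil_left, hw0, shiftW_zero, pack_nil, pack_self hv]
    congr 1
    rw [show shiftW (wmax u) [] = [] from rfl, hs_nil hu0]
  rw [h0] at main
  have e2 : ∀ a b c d e : M, a + b = a + c + d + e → b = d + c + e := by
    intro a b c d e h
    have : a + b = a + (d + c + e) := by rw [h]; abel
    exact add_left_cancel this
  exact e2 _ _ _ _ _ main

end compat

/-! ### Linear algebra -/

noncomputable def Delta : V →ₗ[ℚ] V ⊗[ℚ] V := deltaL + deltaR

theorem ind_Rw {p : V → Prop} (x : V) (h0 : p 0) (ha : ∀ x y, p x → p y → p (x + y))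
    (hs : ∀ (c : ℚ) w, p (c • Rw w)) : p x := by
  induction x using Finsupp.induction_linear with
  | zero => exact h0
  | add f g hf hg => exact ha _ _ hf hg
  | single a b => simpa [Rw] using hs b a

theorem ext_Rw {N : Type*} [AddCommMonoid N] [Module ℚ N] {f g : V →ₗ[ℚ] N}
    (h : ∀ w, f (Rw w) = g (Rw w)) : f = g :=
  Finsupp.lhom_ext' fun w => LinearMap.ext_ring (h w)

theorem lin_Rw {N : Type*} [AddCommMonoid N] [Module ℚ N] (f : List ℕ → N) (w : List ℕ) :
    Finsupp.linearCombination ℚ f (Rw w) = f w := by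
  simp [Rw]

theorem deltaL_Rw (w : List ℕ) : deltaL (Rw w) = cutsL w := by
  simp [deltaL, Rw]
theorem deltaR_Rw (w : List ℕ) : deltaR (Rw w) = cutsR w := by
  simp [deltaR, Rw]

theorem list_sum {N : Type*} [AddCommMonoid N] (n : ℕ) (P : ℕ → Prop) [DecidablePred P]
    (f : ℕ → N) :
    (((List.range n).filter (fun i => decide (P i))).map f).sum =
      ∑ i ∈ (Finset.range n).filter P, f i := by
  rfl

theorem cutsL_eq (w : List ℕ) : cutsL w = ∑ i ∈ (Finset.range w.length).filter (okL w),
    Rw (pack (w.take i)) ⊗ₜ[ℚ] Rw (pack (w.drop i)) := list_sum _ _ _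
theorem cutsR_eq (w : List ℕ) : cutsR w = ∑ i ∈ (Finset.range w.length).filter (okR w),
    Rw (pack (w.take i)) ⊗ₜ[ℚ] Rw (pack (w.drop i)) := list_sum _ _ _

theorem Delta_Rw (w : List ℕ) :
    Delta (Rw w) = ∑ i ∈ C w, Rw (pack (w.take i)) ⊗ₜ[ℚ] Rw (pack (w.drop i)) := by
  rw [Delta, LinearMap.add_apply, deltaL_Rw, deltaR_Rw, cutsL_eq, cutsR_eq]
  by_cases hw : w = []
  · subst hw; simp [C]
  rw [← Finset.sum_union]
  · apply Finset.sum_congr _ (fun _ _ => rfl)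
    ext i
    simp only [Finset.mem_union, Finset.mem_filter, Finset.mem_range, mem_C, okL, okR]
    have hm := wmax_mem hw
    constructor
    · rintro (h | h)
      · exact ⟨h.2.1, h.1, h.2.2.2.1⟩
      · exact ⟨h.2.1, h.1, h.2.2.2.1⟩
    · rintro ⟨h1, h2, h3⟩
      by_cases h : wmax w ∈ w.take i
      · exact Or.inl ⟨h2, h1, h2, h3, h3 _ h⟩
      · exact Or.inr ⟨h2, h1, h2, h3, h⟩
  · rw [Finset.disjoint_left]
    intro i h1 h2
    simp only [Finset.mem_filter, okL, okR] at h1 h2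
    have hm := wmax_mem hw
    rw [← List.take_append_drop i w, List.mem_append] at hm
    rw [List.take_append_drop i w] at hm
    rcases hm with hm | hm
    · exact h2.2.2.2.2 hm
    · exact h1.2.2.2.2 hm

theorem lift_Delta {N : Type*} [AddCommMonoid N] [Module ℚ N] (B : V →ₗ[ℚ] V →ₗ[ℚ] N)
    (w : List ℕ) : TensorProduct.lift B (Delta (Rw w)) =
      ∑ i ∈ C w, B (Rw (pack (w.take i))) (Rw (pack (w.drop i))) := by
  rw [Delta_Rw, map_sum]
  simp only [TensorProduct.lift.tmul]

theorem mulL_Rw (u v : List ℕ) :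
    mulL (Rw u) (Rw v) = hs u (shiftW (wmax u) v) Rw := by
  simp [mulL, Rw, hs, rsum]

theorem map_hs {N N' : Type*} [AddCommMonoid N] [Module ℚ N] [AddCommMonoid N'] [Module ℚ N']
    (f : N →ₗ[ℚ] N') (u v : List ℕ) (g : List ℕ → N) :
    f (hs u v g) = hs u v (fun x => f (g x)) := by
  simp [hs, map_list_sum, Function.comp_def]

noncomputable def F0 (x y : List ℕ) : V ⊗[ℚ] V := Rw x ⊗ₜ[ℚ] Rw y

noncomputable def PhiB (v : List ℕ) : V →ₗ[ℚ] V →ₗ[ℚ] V ⊗[ℚ] V :=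
  Finsupp.linearCombination ℚ fun a => Finsupp.linearCombination ℚ fun b => Phi F0 v a b

theorem PhiB_Rw (v a b : List ℕ) : PhiB v (Rw a) (Rw b) = Phi F0 v a b := by
  rw [PhiB, lin_Rw, lin_Rw]

theorem compat_Rw {u v : List ℕ} (hu : IsPacked u) (hv : IsPacked v) (hu0 : u ≠ [])
    (hv0 : v ≠ []) :
    Delta (mulL (Rw u) (Rw v)) = Rw v ⊗ₜ[ℚ] Rw u +
      ∑ i ∈ C v, Rw (pack (v.take i)) ⊗ₜ[ℚ] mulL (Rw u) (Rw (pack (v.drop i))) +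
      TensorProduct.lift (PhiB v) (Delta (Rw u)) := by
  rw [mulL_Rw, map_hs]
  simp only [Delta_Rw u, Delta_Rw, map_sum, TensorProduct.lift.tmul, PhiB_Rw]
  have := compat_words hu hv hu0 hv0 F0
  simp only [F0] at this
  refine this.trans ?_
  congr 2
  apply Finset.sum_congr rfl
  intro i _
  rw [mulL_Rw]
  exact (map_hs (TensorProduct.mk ℚ V V (Rw (pack (v.take i)))) _ _ _).symm

theorem Rw_mem {w : List ℕ} (h : IsPacked w) (h0 : w ≠ []) : Rw w ∈ Wplus :=
  Submodule.subset_span ⟨w, h, h0, rfl⟩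

theorem eqOn_Wplus {N : Type*} [AddCommMonoid N] [Module ℚ N] {f g : V →ₗ[ℚ] N}
    (h : ∀ w, IsPacked w → w ≠ [] → f (Rw w) = g (Rw w)) {x : V} (hx : x ∈ Wplus) :
    f x = g x := by
  refine LinearMap.eqOn_span (f := f) (g := g) ?_ hx
  rintro _ ⟨w, h1, h2, rfl⟩
  exact h w h1 h2

theorem map_Wplus {N : Type*} [AddCommMonoid N] [Module ℚ N] {f : V →ₗ[ℚ] N} {S : Submodule ℚ N}
    (h : ∀ w, IsPacked w → w ≠ [] → f (Rw w) ∈ S) {x : V} (hx : x ∈ Wplus) :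
    f x ∈ S := by
  have : Wplus ≤ S.comap f := by
    rw [Wplus, Submodule.span_le]
    rintro _ ⟨w, h1, h2, rfl⟩
    exact h w h1 h2
  exact this hx

theorem compat_prim {p : V} (hp : p ∈ Prim) {v : List ℕ} (hv : IsPacked v) (hv0 : v ≠ []) :
    Delta (mulL p (Rw v)) = Rw v ⊗ₜ[ℚ] p +
      ∑ i ∈ C v, Rw (pack (v.take i)) ⊗ₜ[ℚ] mulL p (Rw (pack (v.drop i))) := by
  have key := eqOn_Wplus (f := Delta ∘ₗ mulL.flip (Rw v))
    (g := TensorProduct.mk ℚ V V (Rw v) +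
      (∑ i ∈ C v, TensorProduct.mk ℚ V V (Rw (pack (v.take i))) ∘ₗ
        mulL.flip (Rw (pack (v.drop i)))) +
      TensorProduct.lift (PhiB v) ∘ₗ Delta) (fun u hu hu0 => by
        simpa using compat_Rw hu hv hu0 hv0) hp.1
  have h0 : Delta p = 0 := hp.2
  simpa [h0] using key

theorem mulL_mem {x y : V} (hx : x ∈ Wplus) (hy : y ∈ Wplus) : mulL x y ∈ Wplus := by
  refine map_Wplus (f := mulL.flip y) (fun u hu hu0 => ?_) hx
  refine map_Wplus (f := mulL (Rw u)) (fun v hv hv0 => ?_) hy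
  rw [mulL_Rw]
  unfold hs
  apply list_sum_mem
  intro z hz
  obtain ⟨w, hw, rfl⟩ := List.mem_map.1 hz
  apply Rw_mem
  · have hm := mem_halfShL hu0 hw
    apply packed_of (n := wmax u + wmax v)
    intro x
    rw [hm, packed_mem hu]
    simp only [shiftW, List.mem_map, packed_mem hv]
    constructor
    · rintro (h | ⟨a, h, rfl⟩) <;> omega
    · intro h
      by_cases hx : x ≤ wmax u
      · left; omega
      · right; exact ⟨x - wmax u, by omega, by omega⟩
  · simp only [halfShL, List.mem_map] at hw
    obtain ⟨w', _, rfl⟩ := hw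
    simp

/-- The projector on primitive elements, on words. -/
noncomputable def eW (w : List ℕ) : V :=
  Rw w - ∑ i ∈ (C w).attach, mulL (eW (pack (w.drop i.1))) (Rw (pack (w.take i.1)))
termination_by w.length
decreasing_by
  have := mem_C.1 i.2
  simp; omega

theorem eW_eq (w : List ℕ) :
    eW w = Rw w - ∑ i ∈ C w, mulL (eW (pack (w.drop i))) (Rw (pack (w.take i))) := by
  rw [eW]
  congr 1
  exact Finset.sum_attach (C w) (fun i => mulL (eW (pack (w.drop i))) (Rw (pack (w.take i))))

noncomputable def e : V →ₗ[ℚ] V := Finsupp.linearCombination ℚ eW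

theorem e_Rw (w : List ℕ) : e (Rw w) = eW w := lin_Rw _ _

theorem e_eq (x : V) : e x = x - TensorProduct.lift (mulL ∘ₗ e).flip (Delta x) := by
  have : e = LinearMap.id - TensorProduct.lift (mulL ∘ₗ e).flip ∘ₗ Delta := by
    apply ext_Rw
    intro w
    simp only [LinearMap.sub_apply, LinearMap.comp_apply, LinearMap.id_apply, lift_Delta,
      LinearMap.flip_apply, e_Rw]
    exact eW_eq w
  exact LinearMap.congr_fun this x

theorem e_Rw' (w : List ℕ) :
    e (Rw w) = Rw w - ∑ i ∈ C w, mulL (e (Rw (pack (w.drop i)))) (Rw (pack (w.take i))) := by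
  simp only [e_Rw]; exact eW_eq w

theorem eW_prim (w : List ℕ) (hw : IsPacked w) (hw0 : w ≠ []) : e (Rw w) ∈ Prim := by
  induction hn : w.length using Nat.strong_induction_on generalizing w with
  | _ n ih =>
  have hd : ∀ i ∈ C w, e (Rw (pack (w.drop i))) ∈ Prim := by
    intro i hi
    have := mem_C.1 hi
    exact ih _ (by simp only [pack_length, List.length_drop]; omega) _ (pack_packed _)
      (pack_ne (drop_ne hi)) rfl
  constructor
  · rw [e_Rw']
    refine Submodule.sub_mem _ (Rw_mem hw hw0) (Submodule.sum_mem _ fun i hi => ?_)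
    exact mulL_mem (hd i hi).1 (Rw_mem (pack_packed _) (pack_ne (take_ne hi)))
  · change Delta (e (Rw w)) = 0
    rw [e_Rw', map_sub, map_sum, Finset.sum_congr rfl (fun i hi =>
      compat_prim (hd i hi) (pack_packed (w.take i)) (pack_ne (take_ne hi))),
      Finset.sum_add_distrib,
      coassoc (fun a b c => Rw a ⊗ₜ[ℚ] mulL (e (Rw c)) (Rw b)) w, ← Finset.sum_add_distrib,
      Delta_Rw, sub_eq_zero]
    apply Finset.sum_congr rfl
    intro i hi
    rw [← TensorProduct.tmul_sum, ← TensorProduct.tmul_add]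
    congr 1
    rw [e_Rw' (pack (w.drop i))]
    abel

theorem e_prim {x : V} (hx : x ∈ Wplus) : e x ∈ Prim := map_Wplus eW_prim hx

theorem e_of_prim {p : V} (hp : p ∈ Prim) : e p = p := by
  have : Delta p = 0 := hp.2
  rw [e_eq, this]; simp

theorem e_mul_Rw {p : V} (hp : p ∈ Prim) (w : List ℕ) (hw : IsPacked w) (hw0 : w ≠ []) :
    e (mulL p (Rw w)) = 0 := by
  induction hn : w.length using Nat.strong_induction_on generalizing w with
  | _ n ih =>
  rw [e_eq, compat_prim hp hw hw0, map_add, map_sum]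
  simp only [TensorProduct.lift.tmul, LinearMap.flip_apply, LinearMap.comp_apply, e_of_prim hp]
  rw [Finset.sum_eq_zero, add_zero, sub_self]
  intro i hi
  have := mem_C.1 hi
  rw [ih _ (by simp only [pack_length, List.length_drop]; omega) _ (pack_packed (w.drop i))
    (pack_ne (drop_ne hi)) rfl]
  simp

/-- The projector with values in `Prim`. -/
noncomputable def P : V →ₗ[ℚ] Prim :=
  Finsupp.linearCombination ℚ fun w => if h : e (Rw w) ∈ Prim then ⟨e (Rw w), h⟩ else 0

theorem P_coe {x : V} (hx : x ∈ Wplus) : (P x : V) = e x := by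
  refine eqOn_Wplus (f := Prim.subtype ∘ₗ P) (g := e) (fun w hw hw0 => ?_) hx
  simp only [LinearMap.comp_apply, P, lin_Rw]
  rw [dif_pos (eW_prim w hw hw0)]
  rfl

theorem P_prim (p : Prim) : P p = p := Subtype.ext ((P_coe p.2.1).trans (e_of_prim p.2))

theorem P_mul (p : Prim) {w : List ℕ} (hw : IsPacked w) (hw0 : w ≠ []) :
    P (mulL p (Rw w)) = 0 :=
  Subtype.ext ((P_coe (mulL_mem p.2.1 (Rw_mem hw hw0))).trans (e_mul_Rw p.2 w hw hw0))

abbrev T (k : ℕ) : Type := ⨂[ℚ] (_ : Fin (k + 1)), ↥Prim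
abbrev TT : Type := ⨁ k : ℕ, ⨂[ℚ] (_ : Fin (k + 1)), ↥Prim

noncomputable def consk (k : ℕ) : Prim →ₗ[ℚ] T k →ₗ[ℚ] T (k + 1) :=
  (PiTensorProduct.lift (R := ℚ) (s := fun _ : Fin (k + 1) => ↥Prim)
      (E := T (k + 1))).toLinearMap ∘ₗ
    (PiTensorProduct.tprod ℚ (s := fun _ : Fin (k + 2) => ↥Prim)).curryLeft

theorem consk_tprod (k : ℕ) (p : Prim) (q : Fin (k + 1) → Prim) :
    consk k p (PiTensorProduct.tprod ℚ q) =
      PiTensorProduct.tprod ℚ (Fin.cons p q : Fin (k + 2) → Prim) := by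
  simp only [consk, LinearMap.comp_apply, LinearEquiv.coe_coe]
  rw [PiTensorProduct.lift.tprod]
  rfl

noncomputable def consT : Prim →ₗ[ℚ] TT →ₗ[ℚ] TT :=
  LinearMap.flip (DirectSum.toModule ℚ ℕ (Prim →ₗ[ℚ] TT)
    (fun k => LinearMap.flip
      ((LinearMap.compRight ℚ (DirectSum.lof ℚ ℕ T (k + 1))) ∘ₗ consk k)))

theorem consT_lof (p : Prim) (k : ℕ) (t : T k) :
    consT p (DirectSum.lof ℚ ℕ T k t) = DirectSum.lof ℚ ℕ T (k + 1) (consk k p t) := by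
  simp only [consT, LinearMap.flip_apply]
  erw [DirectSum.toModule_lof]
  rfl

noncomputable def nestM : (k : ℕ) → MultilinearMap ℚ (fun _ : Fin (k + 1) => ↥Prim) V
  | 0 => MultilinearMap.ofSubsingleton ℚ Prim V (0 : Fin 1) Prim.subtype
  | k + 1 => LinearMap.uncurryLeft (M := fun _ : Fin (k + 2) => ↥Prim)
      { toFun := fun x => (mulL x).compMultilinearMap (nestM k)
        map_add' := fun x y => by ext; simp
        map_smul' := fun c x => by ext; simp }

theorem nestM_zero (p : Fin 1 → Prim) : nestM 0 p = p 0 := rfl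
theorem nestM_succ (k : ℕ) (p : Fin (k + 2) → Prim) :
    nestM (k + 1) p = mulL (p 0) (nestM k (Fin.tail p)) := rfl

theorem nestM_eq (k : ℕ) (p : Fin (k + 1) → Prim) :
    nestM k p = nest ((List.ofFn p).map Subtype.val) := by
  induction k with
  | zero => simp [nestM_zero, nest]
  | succ k ih =>
    rw [nestM_succ, ih]
    simp [nest, List.ofFn_succ, Fin.tail]

theorem nestM_mem (k : ℕ) (p : Fin (k + 1) → Prim) : nestM k p ∈ Wplus := by
  induction k with
  | zero => exact (p 0).2.1
  | succ k ih => exact mulL_mem (p 0).2.1 (ih _)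

noncomputable def omega' : TT →ₗ[ℚ] V :=
  DirectSum.toModule ℚ ℕ V (fun k => PiTensorProduct.lift (nestM k))

theorem omega_lof (k : ℕ) (p : Fin (k + 1) → Prim) :
    omega' (DirectSum.lof ℚ ℕ T k (PiTensorProduct.tprod ℚ p)) = nestM k p := by
  unfold omega'
  erw [DirectSum.toModule_lof]
  exact PiTensorProduct.lift.tprod p

theorem TT_ext {N : Type*} [AddCommMonoid N] [Module ℚ N] {f g : TT →ₗ[ℚ] N}
    (h : ∀ k (p : Fin (k + 1) → Prim), f (DirectSum.lof ℚ ℕ T k (PiTensorProduct.tprod ℚ p)) =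
      g (DirectSum.lof ℚ ℕ T k (PiTensorProduct.tprod ℚ p))) : f = g := by
  apply DirectSum.linearMap_ext
  intro k
  apply PiTensorProduct.ext
  ext p
  exact h k p

theorem omega_cons (p : Prim) (t : TT) : omega' (consT p t) = mulL p (omega' t) := by
  have : omega' ∘ₗ consT p = mulL p ∘ₗ omega' := by
    apply TT_ext
    intro k q
    simp only [LinearMap.comp_apply]
    rw [consT_lof, consk_tprod, omega_lof, omega_lof, nestM_succ]
    simp
  exact LinearMap.congr_fun this t

theorem omega_mem (t : TT) : omega' t ∈ Wplus := by
  have : Wplus.mkQ ∘ₗ omega' = 0 := by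
    apply TT_ext
    intro k q
    simp only [LinearMap.comp_apply]
    rw [omega_lof]
    simpa using nestM_mem k q
  have := LinearMap.congr_fun this t
  simpa using this

noncomputable def iota : Prim →ₗ[ℚ] TT :=
  DirectSum.lof ℚ ℕ T 0 ∘ₗ
    (PiTensorProduct.tprod ℚ (s := fun _ : Fin 1 => ↥Prim)).toLinearMap (fun _ => 0) 0

theorem iota_apply (p : Prim) :
    iota p = DirectSum.lof ℚ ℕ T 0 (PiTensorProduct.tprod ℚ (fun _ : Fin 1 => p)) := by
  simp only [iota, LinearMap.comp_apply]
  congr 1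
  simp only [MultilinearMap.toLinearMap_apply]
  congr 1
  ext i
  have : i = 0 := Subsingleton.elim _ _
  subst this
  simp

noncomputable def FW (w : List ℕ) : TT :=
  iota (P (Rw w)) + ∑ i ∈ (C w).attach, consT (P (Rw (pack (w.drop i.1)))) (FW (pack (w.take i.1)))
termination_by w.length
decreasing_by
  have := mem_C.1 i.2
  simp; omega

theorem FW_eq (w : List ℕ) : FW w = iota (P (Rw w)) +
    ∑ i ∈ C w, consT (P (Rw (pack (w.drop i)))) (FW (pack (w.take i))) := by
  rw [FW]
  congr 1
  exact Finset.sum_attach (C w) (fun i => consT (P (Rw (pack (w.drop i)))) (FW (pack (w.take i))))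

noncomputable def F : V →ₗ[ℚ] TT := Finsupp.linearCombination ℚ FW

theorem F_Rw (w : List ℕ) : F (Rw w) = FW w := lin_Rw _ _

theorem F_eq (x : V) :
    F x = iota (P x) + TensorProduct.lift (LinearMap.flip ((consT ∘ₗ P).flip ∘ₗ F).flip) (Delta x) := by
  have : F = iota ∘ₗ P +
      TensorProduct.lift (LinearMap.flip ((consT ∘ₗ P).flip ∘ₗ F).flip) ∘ₗ Delta := by
    apply ext_Rw
    intro w
    simp only [LinearMap.add_apply, LinearMap.comp_apply, lift_Delta,
      LinearMap.flip_apply, F_Rw]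
    exact FW_eq w
  exact LinearMap.congr_fun this x

theorem omega_FW (w : List ℕ) (hw : IsPacked w) (hw0 : w ≠ []) : omega' (F (Rw w)) = Rw w := by
  induction hn : w.length using Nat.strong_induction_on generalizing w with
  | _ n ih =>
  rw [F_Rw, FW_eq, map_add, map_sum, iota_apply, omega_lof, nestM_zero, P_coe (Rw_mem hw hw0),
    e_Rw' w]
  have hs : ∀ a b c : V, c = b → a - b + c = a := by
    intro a b c h; rw [h]; abel
  apply hs
  apply Finset.sum_congr rfl
  intro i hi
  have := mem_C.1 hi
  rw [omega_cons, P_coe (Rw_mem (pack_packed _) (pack_ne (drop_ne hi))), ← F_Rw,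
    ih _ (by simp only [pack_length, List.length_take]; omega) _ (pack_packed (w.take i))
    (pack_ne (take_ne hi)) rfl]

theorem omega_F {x : V} (hx : x ∈ Wplus) : omega' (F x) = x :=
  eqOn_Wplus (f := omega' ∘ₗ F) (g := LinearMap.id) omega_FW hx

theorem F_mul (p : Prim) {x : V} (hx : x ∈ Wplus) : F (mulL p x) = consT p (F x) := by
  refine eqOn_Wplus (f := F ∘ₗ mulL p) (g := consT p ∘ₗ F) (fun w hw hw0 => ?_) hx
  simp only [LinearMap.comp_apply]
  rw [F_eq, P_mul p hw hw0, map_zero, zero_add, compat_prim p.2 hw hw0, map_add, map_sum]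
  simp only [TensorProduct.lift.tmul, LinearMap.flip_apply, LinearMap.comp_apply, P_prim]
  rw [Finset.sum_eq_zero, add_zero]
  intro i hi
  rw [P_mul p (pack_packed _) (pack_ne (drop_ne hi))]
  simp

theorem F_prim (p : Prim) : F p = iota p := by
  have : Delta (p : V) = 0 := p.2.2
  rw [F_eq, this, P_prim]; simp

theorem F_nestM (k : ℕ) (p : Fin (k + 1) → Prim) :
    F (nestM k p) = DirectSum.lof ℚ ℕ T k (PiTensorProduct.tprod ℚ p) := by
  induction k with
  | zero =>
    rw [nestM_zero, F_prim, iota_apply]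
    congr 2
    ext i
    have : i = 0 := Subsingleton.elim _ _
    rw [this]
  | succ k ih =>
    rw [nestM_succ, F_mul _ (nestM_mem _ _), ih, consT_lof, consk_tprod, Fin.cons_self_tail]

theorem F_omega (t : TT) : F (omega' t) = t := by
  have : F ∘ₗ omega' = LinearMap.id := by
    apply TT_ext
    intro k q
    simp only [LinearMap.comp_apply]
    rw [omega_lof, F_nestM]
    rfl
  exact LinearMap.congr_fun this t

noncomputable def equivT : TT ≃ₗ[ℚ] ↥Wplus :=
  LinearEquiv.ofLinearMap (omega'.codRestrict Wplus omega_mem) (F ∘ₗ Wplus.subtype)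
    (by
      ext x : 2
      exact omega_F x.2)
    (by
      apply LinearMap.ext
      intro t
      exact F_omega t)

end WQ

theorem tensor_algebra_iso_of_prim :
    ∃ E : (⨁ k : ℕ, ⨂[ℚ] (_ : Fin (k + 1)), ↥Prim) ≃ₗ[ℚ] ↥Wplus,
      ∀ (k : ℕ) (p : Fin (k + 1) → ↥Prim),
        ((E (DirectSum.of (fun k : ℕ => ⨂[ℚ] (_ : Fin (k + 1)), ↥Prim) k
            (PiTensorProduct.tprod ℚ fun i => p i)) : ↥Wplus) : V) =
          nest ((List.ofFn p).map Subtype.val) := by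
  refine ⟨WQ.equivT, fun k p => ?_⟩
  rw [← WQ.nestM_eq]
  exact WQ.omega_lof k p
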